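/- arXiv:1604.07075 — 3 statements merged into one kernel-verified Lean document; each statement's English description precedes it below -/
import Mathlib

section
/- Let R be a commutative ring and (G,L) an R-network with the property that the only finitely supported function u : V → R with u|_{∂V} = 0 and Lu ≡ 0 is the zero function (non-degeneracy). Then for every R-module M there is a natural isomorphism U₀(G,L,M) ≅ Tor₁^R(Υ(G,L), M), and Tor_j^R(Υ(G,L), M) = 0 for all j > 1, where U₀(G,L,M) is the module of finitely supported functions u : V → M with u|_{∂V} = 0 and Lu ≡ 0. -/
open Finsupp

/-- A graph with boundary (`∂`-graph) together with a generalized Laplacian datum over `R`: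
oriented edges with a fixed-point-free reversal involution, local finiteness,
a set of boundary vertices, symmetric edge weights `w` and diagonal perturbation `d`. -/
structure DNetwork (R : Type) [CommRing R] where
  V : Type
  E : Type
  src : E → V
  rev : E → E
  rev_rev : ∀ e, rev (rev e) = e
  rev_ne : ∀ e, rev e ≠ e
  finE : ∀ x : V, Fintype {e : E // src e = x}
  boundary : Set V
  w : E → R
  w_rev : ∀ e, w (rev e) = w e
  d : V → R

namespace DNetwork

variable {R : Type} [CommRing R] (N : DNetwork R)

/-- The endpoint of an oriented edge. -/
def tgt (e : N.E) : N.V := N.src (N.rev e)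

/-- The generalized Laplacian evaluated at the vertex `x`, as a linear functional on
`M`-valued functions: `Lu(x) = d(x) u(x) + ∑_{e : e₊ = x} w(e) (u(x) - u(e₋))`. -/
noncomputable def lapAt {M : Type} [AddCommGroup M] [Module R M] (x : N.V) :
    (N.V → M) →ₗ[R] M :=
  letI := N.finE x
  N.d x • (LinearMap.proj x : (N.V → M) →ₗ[R] M) +
    ∑ e : {e : N.E // N.src e = x},
      N.w e.1 • ((LinearMap.proj x : (N.V → M) →ₗ[R] M) - LinearMap.proj (N.tgt e.1))

/-- The generalized Laplacian applied to the basis chain at the vertex `x`. -/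
noncomputable def lapSingle (x : N.V) : N.V →₀ R :=
  letI := N.finE x
  N.d x • Finsupp.single x 1 +
    ∑ e : {e : N.E // N.src e = x},
      N.w e.1 • (Finsupp.single x 1 - Finsupp.single (N.tgt e.1) 1)

/-- The generalized Laplacian as a linear endomorphism of the module `RV` of `0`-chains. -/
noncomputable def chainLap : (N.V →₀ R) →ₗ[R] (N.V →₀ R) :=
  Finsupp.lsum R fun x => LinearMap.toSpanSingleton R _ (N.lapSingle x)

/-- The set of interior vertices. -/
def interior : Set N.V := N.boundaryᶜ

/-- The submodule `L(RV°)` of `RV`. -/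
noncomputable def lapImage : Submodule R (N.V →₀ R) :=
  Submodule.map N.chainLap (Finsupp.supported R R N.interior)

/-- The fundamental module `Υ(G,L) = RV / L(RV°)`. -/
abbrev Upsilon := (N.V →₀ R) ⧸ N.lapImage

/-- The submodule of `M`-valued harmonic functions `U(G,L,M)`. -/
noncomputable def harmonic (M : Type) [AddCommGroup M] [Module R M] :
    Submodule R (N.V → M) :=
  ⨅ x ∈ N.interior, LinearMap.ker (N.lapAt (M := M) x)

/-- The module `U₀(G,L,M)` of finitely supported `M`-valued functions `u` with
`u = 0` on the boundary and `Lu ≡ 0` everywhere. -/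
noncomputable def U0 (M : Type) [AddCommGroup M] [Module R M] :
    Submodule R (N.V →₀ M) :=
  (⨅ x ∈ N.boundary, LinearMap.ker (Finsupp.lapply (M := M) (R := R) x)) ⊓
    (⨅ x : N.V, LinearMap.ker ((N.lapAt (M := M) x).comp Finsupp.lcoeFun))

/-- Adjacency via an oriented edge. -/
def Adj (x y : N.V) : Prop := ∃ e : N.E, N.src e = x ∧ N.tgt e = y

/-- Connectivity of the underlying graph. -/
def Connected : Prop := ∀ x y : N.V, Relation.ReflTransGen N.Adj x y

end DNetwork

open CategoryTheory

namespace CategoryTheory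

open Limits

variable {C D : Type*} [Category* C] [Abelian C] [Category* D] [Abelian D]

section

variable {F G H : C ⥤ D} [F.Additive] [G.Additive] [H.Additive] (α : F ⟶ G) (β : G ⟶ H)
  (w : ∀ X, α.app X ≫ β.app X = 0)

/-- The sequence `F P ⟶ G P ⟶ H P` of chain complexes induced by a sequence of functors
`F ⟶ G ⟶ H`. -/
noncomputable def NatTrans.shortComplexMapHomologicalComplex (P : ChainComplex C ℕ) :
    ShortComplex (ChainComplex D ℕ) where
  X₁ := (F.mapHomologicalComplex _).obj P
  X₂ := (G.mapHomologicalComplex _).obj P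
  X₃ := (H.mapHomologicalComplex _).obj P
  f := (NatTrans.mapHomologicalComplex α _).app P
  g := (NatTrans.mapHomologicalComplex β _).app P
  zero := by
    ext i
    exact w _

lemma NatTrans.shortExact_shortComplexMapHomologicalComplex
    (hproj : ∀ (X : C) [Projective X], (ShortComplex.mk _ _ (w X)).ShortExact) {X : C}
    (P : ProjectiveResolution X) :
    (NatTrans.shortComplexMapHomologicalComplex α β w P.complex).ShortExact :=
  HomologicalComplex.shortExact_of_degreewise_shortExact _ fun i => hproj (P.complex.X i)

end

variable [HasProjectiveResolutions C]

/-- The higher left derived functors of an exact functor vanish. -/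
lemma Functor.isZero_leftDerived_succ_of_exact (F : C ⥤ D) [F.Additive]
    [PreservesFiniteLimits F] [PreservesFiniteColimits F] (X : C) (n : ℕ) :
    IsZero ((F.leftDerived (n + 1)).obj X) := by
  let P := projectiveResolution X
  refine IsZero.of_iso ?_ (P.isoLeftDerivedObj F (n + 1))
  refine (HomologicalComplex.exactAt_iff_isZero_homology _ _).1 ?_
  exact (HomologicalComplex.exactAt_iff' _ (n + 2) (n + 1) n (by simp only [ChainComplex.prev]; rfl)
    (by simp)).2 ((P.exact_succ n).map F)

/-- The comparison `F.leftDerived 0 ⟶ F` is natural in `F`. -/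
lemma NatTrans.leftDerived_zero_app_comp_fromLeftDerivedZero {F G : C ⥤ D} [F.Additive]
    [G.Additive] (α : F ⟶ G) (X : C) :
    (NatTrans.leftDerived α 0).app X ≫ G.fromLeftDerivedZero.app X =
      F.fromLeftDerivedZero.app X ≫ α.app X := by
  let P := projectiveResolution X
  rw [P.leftDerived_app_eq α 0, P.fromLeftDerivedZero_eq F, P.fromLeftDerivedZero_eq G]
  simp only [Category.assoc, Iso.inv_hom_id_assoc]
  have h : HomologicalComplex.opcyclesMap
      ((NatTrans.mapHomologicalComplex α _).app P.complex) 0 ≫ P.fromLeftDerivedZero' G =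
      P.fromLeftDerivedZero' F ≫ α.app X := by
    simp only [← cancel_epi (HomologicalComplex.pOpcycles _ _),
      HomologicalComplex.p_opcyclesMap_assoc,
      ProjectiveResolution.pOpcycles_comp_fromLeftDerivedZero',
      ProjectiveResolution.pOpcycles_comp_fromLeftDerivedZero'_assoc]
    exact (α.naturality _).symm
  exact congrArg ((P.isoLeftDerivedObj F 0).hom ≫ ·)
    ((HomologicalComplex.homologyι_naturality_assoc _ _ _).trans
      ((congrArg (HomologicalComplex.homologyι _ 0 ≫ ·) h).trans (Category.assoc _ _ _).symm))

/-- Dimension shifting in the functor variable. -/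
lemma Functor.isZero_leftDerived_of_shortExact {F G H : C ⥤ D}
    [F.Additive] [G.Additive] [H.Additive] (α : F ⟶ G) (β : G ⟶ H)
    (w : ∀ X, α.app X ≫ β.app X = 0)
    (hproj : ∀ (X : C) [Projective X], (ShortComplex.mk _ _ (w X)).ShortExact)
    (X : C) (n : ℕ) (hF : IsZero ((F.leftDerived n).obj X))
    (hG : IsZero ((G.leftDerived (n + 1)).obj X)) :
    IsZero ((H.leftDerived (n + 1)).obj X) := by
  let P := projectiveResolution X
  have hS := NatTrans.shortExact_shortComplexMapHomologicalComplex α β w hproj P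
  refine IsZero.of_iso ?_ (P.isoLeftDerivedObj H (n + 1))
  exact (hS.homology_exact₃ (n + 1) n (by simp)).isZero_of_both_zeros
    ((hG.of_iso (P.isoLeftDerivedObj G (n + 1)).symm).eq_of_src _ _)
    ((hF.of_iso (P.isoLeftDerivedObj F n).symm).eq_of_tgt _ _)

/-- If `F ⟶ G ⟶ H` is short exact on projectives, `F` and `G` are right exact, and the first left
derived functor of `G` vanishes at `X`, then the first left derived functor of `H` at `X` is the
kernel of `F.obj X ⟶ G.obj X`. -/
noncomputable def Functor.leftDerivedOneIsoKernel {F G H : C ⥤ D}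
    [F.Additive] [G.Additive] [H.Additive] [PreservesFiniteColimits F]
    [PreservesFiniteColimits G] (α : F ⟶ G) (β : G ⟶ H)
    (w : ∀ X, α.app X ≫ β.app X = 0)
    (hproj : ∀ (X : C) [Projective X], (ShortComplex.mk _ _ (w X)).ShortExact)
    (X : C) (hG : IsZero ((G.leftDerived 1).obj X)) :
    (H.leftDerived 1).obj X ≅ Limits.kernel (α.app X) :=
  let P := projectiveResolution X
  have hS := NatTrans.shortExact_shortComplexMapHomologicalComplex α β w hproj P
  have hrel : (ComplexShape.down ℕ).Rel 1 0 := by simp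
  have hδ : Mono (hS.δ 1 0 hrel) :=
    (hS.homology_exact₃ 1 0 hrel).mono_g
      ((hG.of_iso (P.isoLeftDerivedObj G 1).symm).eq_of_src _ _)
  P.isoLeftDerivedObj H 1 ≪≫
    (IsLimit.conePointUniqueUpToIso (hS.homology_exact₁ 1 0 hrel).fIsKernel
      (kernelIsKernel _)) ≪≫
    kernel.mapIso _ ((NatTrans.leftDerived α 0).app X) (P.isoLeftDerivedObj F 0).symm
      (P.isoLeftDerivedObj G 0).symm (by
        rw [P.leftDerived_app_eq α 0]
        exact (Iso.inv_hom_id_assoc _ _).symm) ≪≫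
    kernel.mapIso _ _ (asIso (F.fromLeftDerivedZero.app X)) (asIso (G.fromLeftDerivedZero.app X))
      (NatTrans.leftDerived_zero_app_comp_fromLeftDerivedZero α X)

end CategoryTheory

namespace ModuleCat

variable {R : Type} [CommRing R]

instance preservesFiniteColimits_tensoringLeft_obj (X : ModuleCat R) :
    Limits.PreservesFiniteColimits ((MonoidalCategory.tensoringLeft (ModuleCat R)).obj X) :=
  inferInstanceAs (Limits.PreservesFiniteColimits (MonoidalCategory.tensorLeft X))

instance preservesFiniteLimits_tensoringLeft_obj (X : ModuleCat R) [Module.Flat R X] :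
    Limits.PreservesFiniteLimits ((MonoidalCategory.tensoringLeft (ModuleCat R)).obj X) :=
  inferInstanceAs (Limits.PreservesFiniteLimits (MonoidalCategory.tensorLeft X))

end ModuleCat

namespace DNetwork

variable {R : Type} [CommRing R] (N : DNetwork R) {M : Type} [AddCommGroup M]

lemma mapDomain_val_eq_zero_of_mem_boundary (u : N.interior →₀ M) {x : N.V}
    (hx : x ∈ N.boundary) : Finsupp.mapDomain Subtype.val u x = 0 :=
  Finsupp.mapDomain_of_notMem_range _ _ (by simpa [interior] using hx)

variable [Module R M]

/-- The generalized Laplacian is symmetric. -/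
lemma lapSingle_smul_eq_lapAt_single (x y : N.V) (m : M) :
    N.lapSingle x y • m = N.lapAt y (Finsupp.single x m) := by
  classical
  let _ := N.finE x
  let _ := N.finE y
  have hsum : ∑ e : {e : N.E // N.src e = x}, N.w e.1 • (if N.tgt e.1 = y then m else 0) =
      ∑ e : {e : N.E // N.src e = y}, N.w e.1 • (if N.tgt e.1 = x then m else 0) := by
    simp only [smul_ite, smul_zero, ← Finset.sum_filter]
    refine Finset.sum_bij' (fun e he => ⟨N.rev e.1, (Finset.mem_filter.1 he).2⟩)
      (fun e he => ⟨N.rev e.1, (Finset.mem_filter.1 he).2⟩) ?_ ?_ ?_ ?_ ?_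
    · rintro ⟨e, rfl⟩ he
      exact Finset.mem_filter.2 ⟨Finset.mem_univ _, congrArg N.src (N.rev_rev e)⟩
    · rintro ⟨e, rfl⟩ he
      exact Finset.mem_filter.2 ⟨Finset.mem_univ _, congrArg N.src (N.rev_rev e)⟩
    · simp [N.rev_rev]
    · simp [N.rev_rev]
    · simp [N.w_rev]
  have hL : N.lapSingle x y • m = N.d x • (if x = y then m else 0) +
      (∑ e : {e : N.E // N.src e = x}, N.w e.1 • (if x = y then m else 0) -
        ∑ e : {e : N.E // N.src e = x}, N.w e.1 • (if N.tgt e.1 = y then m else 0)) := by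
    simp [lapSingle, Finsupp.single_apply, add_smul, Finset.sum_smul,
      mul_sub, sub_smul, Finset.sum_sub_distrib]
  have hR : N.lapAt y (Finsupp.single x m) = N.d y • (if x = y then m else 0) +
      (∑ e : {e : N.E // N.src e = y}, N.w e.1 • (if x = y then m else 0) -
        ∑ e : {e : N.E // N.src e = y}, N.w e.1 • (if N.tgt e.1 = x then m else 0)) := by
    simp [lapAt, Finsupp.single_apply, smul_sub, Finset.sum_sub_distrib, eq_comm]
  rw [hL, hR, hsum]
  by_cases h : x = y
  · subst h
    rfl
  · simp [h]

lemma chainLap_apply (u : N.V →₀ R) (y : N.V) : N.chainLap u y = N.lapAt y u := by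
  have : Finsupp.lapply y ∘ₗ N.chainLap = N.lapAt y ∘ₗ Finsupp.lcoeFun := by
    ext x
    simpa [chainLap] using N.lapSingle_smul_eq_lapAt_single x y (1 : R)
  exact LinearMap.congr_fun this u

open scoped Classical

/-- Under `RV ⊗ M ≃ (V →₀ M)`, the map `L ⊗ M` is the Laplacian on `M`-valued functions. -/
lemma finsuppScalarLeft_rTensor_chainLap (t : TensorProduct R (N.V →₀ R) M) (y : N.V) :
    TensorProduct.finsuppScalarLeft R M N.V (N.chainLap.rTensor M t) y =
      N.lapAt y (TensorProduct.finsuppScalarLeft R M N.V t) := by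
  induction t with
  | zero => simp
  | add s t hs ht => simp [hs, ht]
  | tmul u m =>
    have : (LinearMap.toSpanSingleton R M m ∘ₗ Finsupp.lapply y) ∘ₗ N.chainLap =
        N.lapAt y ∘ₗ Finsupp.lcoeFun ∘ₗ Finsupp.mapRange.linearMap
          (LinearMap.toSpanSingleton R M m) := by
      ext x
      simpa [chainLap] using N.lapSingle_smul_eq_lapAt_single x y m
    have h := LinearMap.congr_fun this u
    have h' : TensorProduct.finsuppScalarLeft R M N.V (u ⊗ₜ m) =
        Finsupp.mapRange.linearMap (LinearMap.toSpanSingleton R M m) u := by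
      ext z
      simp
    rw [h']
    simpa using h

/-- The restriction of the Laplacian to `RV°`. -/
noncomputable def interiorLap : (N.interior →₀ R) →ₗ[R] (N.V →₀ R) :=
  N.chainLap ∘ₗ Finsupp.lmapDomain R R Subtype.val

lemma mem_U0_iff (u : N.V →₀ M) :
    u ∈ N.U0 M ↔ (∀ x ∈ N.boundary, u x = 0) ∧ ∀ x, N.lapAt x u = 0 := by
  simp [U0, Submodule.mem_iInf]

lemma interiorLap_injective (hnd : N.U0 R = ⊥) : Function.Injective N.interiorLap := by
  rw [injective_iff_map_eq_zero]
  intro u hu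
  have hmem : Finsupp.mapDomain Subtype.val u ∈ N.U0 R :=
    (N.mem_U0_iff _).2 ⟨fun x hx => N.mapDomain_val_eq_zero_of_mem_boundary u hx, fun x => by
      rw [← N.chainLap_apply]
      exact DFunLike.congr_fun hu x⟩
  rw [hnd, Submodule.mem_bot] at hmem
  exact Finsupp.mapDomain_injective Subtype.val_injective (hmem.trans Finsupp.mapDomain_zero.symm)

lemma range_interiorLap : LinearMap.range N.interiorLap = N.lapImage := by
  rw [interiorLap, LinearMap.range_comp, lapImage]
  congr 1
  rw [Finsupp.range_lmapDomain, Finsupp.supported_eq_span_single]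
  congr 1
  ext; simp

lemma finsuppScalarLeft_rTensor_lmapDomain (t : TensorProduct R (N.interior →₀ R) M) :
    TensorProduct.finsuppScalarLeft R M N.V
        ((Finsupp.lmapDomain R R Subtype.val).rTensor M t) =
      Finsupp.mapDomain Subtype.val
        (TensorProduct.finsuppScalarLeft R M N.interior t) := by
  have : (TensorProduct.finsuppScalarLeft R M N.V).toLinearMap ∘ₗ
      (Finsupp.lmapDomain R R Subtype.val).rTensor M =
      Finsupp.lmapDomain M R Subtype.val ∘ₗ
        (TensorProduct.finsuppScalarLeft R M N.interior).toLinearMap := by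
    ext x m : 4
    simp [TensorProduct.finsuppScalarLeft_apply_tmul]
  exact LinearMap.congr_fun this t

lemma mapDomain_mem_U0_iff (t : TensorProduct R (N.interior →₀ R) M) :
    Finsupp.mapDomain Subtype.val (TensorProduct.finsuppScalarLeft R M N.interior t) ∈ N.U0 M ↔
      t ∈ LinearMap.ker (N.interiorLap.rTensor M) := by
  rw [mem_U0_iff, and_iff_right fun x hx => N.mapDomain_val_eq_zero_of_mem_boundary _ hx,
    LinearMap.mem_ker, interiorLap, LinearMap.rTensor_comp_apply,
    ← (TensorProduct.finsuppScalarLeft R M N.V).map_eq_zero_iff, Finsupp.ext_iff]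
  simp only [finsuppScalarLeft_rTensor_chainLap, finsuppScalarLeft_rTensor_lmapDomain,
    Finsupp.coe_zero, Pi.zero_apply]

variable (M) in
/-- `U₀(G,L,M)` is the kernel of `L ⊗ M : RV° ⊗ M → RV ⊗ M`. -/
noncomputable def kerRTensorEquivU0 : LinearMap.ker (N.interiorLap.rTensor M) ≃ₗ[R] N.U0 M :=
  LinearEquiv.ofBijective
    ((Finsupp.lmapDomain M R Subtype.val ∘ₗ
      (TensorProduct.finsuppScalarLeft R M N.interior).toLinearMap).restrict
        fun t ht => (N.mapDomain_mem_U0_iff t).2 ht) <| by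
    constructor
    · rintro ⟨s, hs⟩ ⟨t, ht⟩ h
      have h := congrArg Subtype.val h
      exact Subtype.ext ((TensorProduct.finsuppScalarLeft R M N.interior).injective
        (Finsupp.mapDomain_injective Subtype.val_injective h))
    · rintro ⟨u, hu⟩
      have hrange : Finsupp.mapDomain Subtype.val
          (u.comapDomain (Subtype.val : N.interior → N.V) Subtype.val_injective.injOn) = u := by
        refine Finsupp.mapDomain_comapDomain _ Subtype.val_injective u fun x hx => ?_
        rw [Subtype.range_coe]
        exact fun hb => Finsupp.mem_support_iff.1 hx (((N.mem_U0_iff u).1 hu).1 x hb)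
      have key : Finsupp.mapDomain Subtype.val
          (TensorProduct.finsuppScalarLeft R M N.interior
            ((TensorProduct.finsuppScalarLeft R M N.interior).symm
              (u.comapDomain Subtype.val Subtype.val_injective.injOn))) = u := by
        rw [LinearEquiv.apply_symm_apply, hrange]
      exact ⟨⟨_, (N.mapDomain_mem_U0_iff _).1 (key.symm ▸ hu)⟩, Subtype.ext key⟩

/-- The free resolution `0 ⟶ RV° ⟶ RV ⟶ Υ(G,L) ⟶ 0` of a non-degenerate network. -/
noncomputable def upsilonShortComplex : ShortComplex (ModuleCat R) where
  X₁ := ModuleCat.of R (N.interior →₀ R)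
  X₂ := ModuleCat.of R (N.V →₀ R)
  X₃ := ModuleCat.of R N.Upsilon
  f := ModuleCat.ofHom N.interiorLap
  g := ModuleCat.ofHom N.lapImage.mkQ
  zero := by
    ext1
    exact LinearMap.range_le_ker_iff.1
      (N.range_interiorLap.trans (Submodule.ker_mkQ _).symm).le

lemma upsilonShortComplex_shortExact (hnd : N.U0 R = ⊥) : N.upsilonShortComplex.ShortExact where
  exact := by
    rw [ShortComplex.moduleCat_exact_iff_range_eq_ker]
    exact N.range_interiorLap.trans (Submodule.ker_mkQ _).symm
  mono_f := (ModuleCat.mono_iff_injective _).2 (N.interiorLap_injective hnd)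
  epi_g := (ModuleCat.epi_iff_surjective _).2 (Submodule.mkQ_surjective _)

end DNetwork

/-- for a non-degenerate network, `U₀(G,L,M) ≅ Tor₁(Υ(G,L), M)` and the
higher `Tor`'s vanish. -/
theorem u0_iso_tor_one {R : Type} [CommRing R] (N : DNetwork R)
    (hnd : N.U0 R = ⊥)
    (M : Type) [AddCommGroup M] [Module R M] :
    Nonempty ((((Tor (ModuleCat R) 1).obj (ModuleCat.of R N.Upsilon)).obj (ModuleCat.of R M)) ≅
        ModuleCat.of R (N.U0 M)) ∧
      ∀ j : ℕ, 1 < j →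
        Limits.IsZero (((Tor (ModuleCat R) j).obj (ModuleCat.of R N.Upsilon)).obj
          (ModuleCat.of R M)) := by
  let S := N.upsilonShortComplex
  let T := MonoidalCategory.tensoringLeft (ModuleCat R)
  have hS : S.ShortExact := N.upsilonShortComplex_shortExact hnd
  have : Module.Flat R S.X₁ := inferInstanceAs (Module.Flat R (N.interior →₀ R))
  have : Module.Flat R S.X₂ := inferInstanceAs (Module.Flat R (N.V →₀ R))
  have w (X : ModuleCat R) : (T.map S.f).app X ≫ (T.map S.g).app X = 0 :=
    (S.map (MonoidalCategory.tensorRight X)).zero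
  have hproj (X : ModuleCat R) [Projective X] : (ShortComplex.mk _ _ (w X)).ShortExact := by
    have : Module.Projective R X := (IsProjective.iff_projective X).2 inferInstance
    exact hS.map_of_exact (MonoidalCategory.tensorRight X)
  refine ⟨⟨?_⟩, fun j hj => ?_⟩
  · exact Functor.leftDerivedOneIsoKernel (T.map S.f) (T.map S.g) w hproj _
      (Functor.isZero_leftDerived_succ_of_exact _ _ 0) ≪≫
      ModuleCat.kernelIsoKer _ ≪≫ (N.kerRTensorEquivU0 M).toModuleIso
  · obtain ⟨n, rfl⟩ : ∃ n, j = n + 1 + 1 := ⟨j - 2, by omega⟩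
    exact Functor.isZero_leftDerived_of_shortExact (T.map S.f) (T.map S.g) w hproj _ _
      (Functor.isZero_leftDerived_succ_of_exact _ _ n)
      (Functor.isZero_leftDerived_succ_of_exact _ _ (n + 1))
end

section
/- Let T be the 2n × 2n integer matrix [[4E^{−1}, −I],[I, 0]] where E is the n × n matrix with 1's on and directly above the skew-diagonal. Then for every s ≥ 2, T^{2^s} ≡ I + 2^{s+1} [[0, E^{−1}],[−E^{−1}, 0]] (mod 2^{s+2}), and consequently for odd r, the kernel of T^{r·2^s} − I acting on (ℤ[1/2]/ℤ)^{2n} is isomorphic to (ℤ/2^{s+1})^{2n}. -/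
/-- The `n × n` integer matrix with `1`'s on and directly above the skew-diagonal. -/
def skewE (n : ℕ) : Matrix (Fin n) (Fin n) ℤ :=
  fun i j => if (i : ℕ) + (j : ℕ) + 1 = n ∨ (i : ℕ) + (j : ℕ) + 2 = n then 1 else 0

/-- The `2n × 2n` propagation matrix `T = [[4E⁻¹, -I], [I, 0]]`. -/
noncomputable def propT (n : ℕ) : Matrix (Fin n ⊕ Fin n) (Fin n ⊕ Fin n) ℤ :=
  Matrix.fromBlocks ((4 : ℤ) • (skewE n)⁻¹) (-1) 1 0

/-- The action of an integer matrix on `M`-valued vectors, for a `ℤ`-module `M`. -/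
noncomputable def matAct {ι : Type} [Fintype ι] (A : Matrix ι ι ℤ)
    (M : Type) [AddCommGroup M] : (ι → M) →ₗ[ℤ] (ι → M) :=
  LinearMap.pi fun i => ∑ j, A i j • LinearMap.proj j

/-- `ℤ[1/2]/ℤ`, the 2-primary part of `ℚ/ℤ`, as a `ℤ`-module. -/
abbrev ZHalfModZ : Type :=
  Localization.Away (2 : ℤ) ⧸
    LinearMap.range ((Int.castAddHom (Localization.Away (2 : ℤ))).toIntLinearMap)

theorem isUnit_det_skewE (n : ℕ) : IsUnit (skewE n).det := by
  have htri : ((skewE n).submatrix id (Fin.revPerm : Equiv.Perm (Fin n))).BlockTriangular id := by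
    intro i j hij
    have h : (j : ℕ) < i := hij
    have := i.isLt
    simp only [Matrix.submatrix_apply, skewE, id, Fin.revPerm_apply, Fin.val_rev]
    rw [if_neg (by omega)]
  have h := Matrix.det_of_isUpperTriangular htri
  rw [Matrix.det_permute'] at h
  have hdiag : ∀ i : Fin n, (skewE n).submatrix id (Fin.revPerm : Equiv.Perm (Fin n)) i i = 1 := by
    intro i
    have := i.isLt
    simp only [Matrix.submatrix_apply, skewE, id, Fin.revPerm_apply, Fin.val_rev]
    rw [if_pos (by omega)]
  rw [Finset.prod_congr rfl fun i _ => hdiag i, Finset.prod_const_one] at h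
  exact IsUnit.of_mul_eq_one_right _ h

/-- The matrix `[[0, E⁻¹], [-E⁻¹, 0]]` governing the powers `T ^ 2 ^ s` to leading order. -/
noncomputable def leadingBlock (n : ℕ) : Matrix (Fin n ⊕ Fin n) (Fin n ⊕ Fin n) ℤ :=
  Matrix.fromBlocks 0 (skewE n)⁻¹ (-(skewE n)⁻¹) 0

theorem exists_mul_leadingBlock_eq_one (n : ℕ) : ∃ N, N * leadingBlock n = 1 := by
  refine ⟨Matrix.fromBlocks 0 (-skewE n) (skewE n) 0, ?_⟩
  simp [leadingBlock, Matrix.fromBlocks_multiply, Matrix.mul_nonsing_inv _ (isUnit_det_skewE n)]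

theorem exists_sq_eq_one_add_smul {R : Type*} [Ring R] (M A : R) (c : ℤ) :
    ∃ B, (1 + (2 * (2 * c)) • (M + (2 : ℤ) • A)) ^ 2
      = 1 + (2 * (2 * (2 * c))) • (M + (2 : ℤ) • B) := by
  refine ⟨A + c • ((M + (2 : ℤ) • A) * (M + (2 : ℤ) • A)), ?_⟩
  simp only [pow_two, mul_add, add_mul, smul_mul_assoc, mul_smul_comm, one_mul, mul_one]
  module

theorem exists_propT_pow_two_pow_eq (n s : ℕ) :
    ∃ A, propT n ^ 2 ^ (s + 2) = 1 + (2 ^ (s + 3) : ℤ) • (leadingBlock n + (2 : ℤ) • A) := by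
  induction s with
  | zero =>
    obtain ⟨P, hP⟩ : ∃ P, propT n ^ 2 = -1 - (4 : ℤ) • leadingBlock n + (16 : ℤ) • P := by
      refine ⟨Matrix.fromBlocks ((skewE n)⁻¹ * (skewE n)⁻¹) 0 0 0, ?_⟩
      rw [← Matrix.fromBlocks_one]
      simp only [pow_two, propT, leadingBlock, Matrix.fromBlocks_multiply,
        Matrix.fromBlocks_smul, Matrix.fromBlocks_neg, sub_eq_add_neg, Matrix.fromBlocks_add]
      congr 1 <;> simp only [smul_mul_assoc, mul_smul_comm, mul_zero, mul_one, one_mul,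
        mul_neg, neg_zero, zero_add, add_zero, smul_zero, smul_neg, smul_smul] <;> module
    generalize leadingBlock n = M at hP ⊢
    refine ⟨M * M - (2 : ℤ) • P - (4 : ℤ) • (M * P + P * M) + (16 : ℤ) • (P * P), ?_⟩
    rw [show 2 ^ (0 + 2) = 2 * 2 from rfl, pow_mul, hP]
    simp only [pow_two, sub_eq_add_neg, mul_add, add_mul, smul_mul_assoc, mul_smul_comm, neg_mul,
      mul_neg, one_mul, mul_one]
    module
  | succ s ih =>
    obtain ⟨A, hA⟩ := ih
    obtain ⟨B, hB⟩ := exists_sq_eq_one_add_smul (leadingBlock n) A (2 ^ (s + 1))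
    refine ⟨B, ?_⟩
    rw [show s + 1 + 2 = s + 2 + 1 from rfl, pow_succ, pow_mul, hA]
    simpa only [← pow_succ'] using hB

theorem exists_pow_eq_one_add_smul {R : Type*} [Ring R] (M A : R) (c : ℤ) (r : ℕ) :
    ∃ B, (1 + (2 * c) • (M + (2 : ℤ) • A)) ^ r
      = 1 + (2 * c) • ((r : ℤ) • M + (2 : ℤ) • B) := by
  induction r with
  | zero => exact ⟨0, by simp⟩
  | succ r ih =>
    obtain ⟨B, hB⟩ := ih
    refine ⟨B + A + c • (((r : ℤ) • M + (2 : ℤ) • B) * (M + (2 : ℤ) • A)), ?_⟩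
    rw [pow_succ, hB]
    simp only [mul_add, add_mul, smul_mul_assoc, mul_smul_comm, one_mul, mul_one]
    push_cast
    module

section MatAct

variable {ι : Type} [Fintype ι] (M : Type) [AddCommGroup M]

theorem matAct_apply (A : Matrix ι ι ℤ) (x : ι → M) (i : ι) :
    matAct A M x i = ∑ j, A i j • x j := by
  simp [matAct]

theorem matAct_add (A B : Matrix ι ι ℤ) : matAct (A + B) M = matAct A M + matAct B M := by
  refine LinearMap.ext fun x => funext fun i => ?_
  simp [matAct_apply, add_smul, Finset.sum_add_distrib]

theorem matAct_smul (c : ℤ) (A : Matrix ι ι ℤ) : matAct (c • A) M = c • matAct A M := by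
  refine LinearMap.ext fun x => funext fun i => ?_
  simp [matAct_apply, mul_smul, Finset.smul_sum]

theorem matAct_one [DecidableEq ι] : matAct (1 : Matrix ι ι ℤ) M = LinearMap.id := by
  refine LinearMap.ext fun x => funext fun i => ?_
  simp [matAct_apply, Matrix.one_apply, ite_smul]

theorem matAct_mul (A B : Matrix ι ι ℤ) : matAct (A * B) M = matAct A M ∘ₗ matAct B M := by
  refine LinearMap.ext fun x => funext fun i => ?_
  simp only [LinearMap.comp_apply, matAct_apply, Matrix.mul_apply, Finset.sum_smul, mul_smul,
    Finset.smul_sum]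
  exact Finset.sum_comm

/-- A matrix that is left invertible modulo `2` acts injectively on `2`-power torsion. -/
theorem eq_zero_of_matAct_eq_zero [DecidableEq ι] {N L A : Matrix ι ι ℤ} (hN : N * L = 1) (k : ℕ)
    {x : ι → M} (hx : (2 ^ k : ℤ) • x = 0) (h : matAct (L + (2 : ℤ) • A) M x = 0) : x = 0 := by
  induction k with
  | zero => simpa using hx
  | succ k ih =>
    refine ih ?_
    have h2 : matAct (N * (L + (2 : ℤ) • A)) M x = 0 := by
      rw [matAct_mul, LinearMap.comp_apply, h, map_zero]
    rw [mul_add, hN, mul_smul_comm, matAct_add, matAct_one, matAct_smul, LinearMap.add_apply,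
      LinearMap.id_apply, LinearMap.smul_apply, ← map_smul] at h2
    have h3 := congrArg (fun y => (2 ^ k : ℤ) • y) h2
    simp only [smul_add, smul_zero, ← map_smul, smul_smul] at h3
    rwa [← pow_succ, hx, map_zero, add_zero] at h3

theorem mem_ker_matAct_smul [DecidableEq ι] {N L A : Matrix ι ι ℤ} (hN : N * L = 1) (k : ℕ)
    (htors : ∀ m : M, ∃ j : ℕ, (2 ^ j : ℤ) • m = 0) {x : ι → M} :
    x ∈ LinearMap.ker (matAct ((2 ^ k : ℤ) • (L + (2 : ℤ) • A)) M) ↔ (2 ^ k : ℤ) • x = 0 := by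
  rw [LinearMap.mem_ker, matAct_smul, LinearMap.smul_apply, ← map_smul]
  refine ⟨fun h => ?_, fun h => by rw [h, map_zero]⟩
  choose j hj using htors
  refine eq_zero_of_matAct_eq_zero M hN (∑ i, j (x i)) (funext fun i => ?_) h
  rw [← Finset.add_sum_erase _ _ (Finset.mem_univ i), pow_add, Pi.smul_apply, Pi.smul_apply,
    smul_comm, mul_comm, mul_smul, hj, smul_zero, smul_zero, Pi.zero_apply]

end MatAct

theorem exists_two_pow_smul_zHalfModZ_eq_zero (x : ZHalfModZ) :
    ∃ j : ℕ, (2 ^ j : ℤ) • x = 0 := by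
  obtain ⟨z, rfl⟩ := Submodule.Quotient.mk_surjective _ x
  obtain ⟨⟨m, ⟨_, j, rfl⟩⟩, h⟩ := IsLocalization.surj (Submonoid.powers (2 : ℤ)) z
  refine ⟨j, ?_⟩
  rw [← Submodule.Quotient.mk_smul, Submodule.Quotient.mk_eq_zero]
  refine ⟨m, ?_⟩
  change (m : Localization.Away (2 : ℤ)) = _
  simp only [map_pow, eq_intCast] at h
  rw [← h, zsmul_eq_mul, mul_comm]
  push_cast
  rfl

/-- The `2 ^ k`-torsion of `ℤ[1/2]/ℤ` is cyclic of order `2 ^ k`, generated by `1 / 2 ^ k`. -/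
theorem exists_zmod_linearMap_zHalfModZ (k : ℕ) :
    ∃ f : ZMod (2 ^ k) →ₗ[ℤ] ZHalfModZ, Function.Injective f ∧
      ∀ x, (∃ y, f y = x) ↔ (2 ^ k : ℤ) • x = 0 := by
  have hu : IsUnit ((2 : Localization.Away (2 : ℤ)) ^ k) := by
    have := IsLocalization.Away.algebraMap_isUnit (S := Localization.Away (2 : ℤ)) (2 : ℤ)
    simpa using this.pow k
  obtain ⟨u, hu⟩ := hu.exists_right_inv
  have hcast : Function.Injective (Int.cast : ℤ → Localization.Away (2 : ℤ)) := by
    have := IsLocalization.injective (Localization.Away (2 : ℤ)) (M := Submonoid.powers (2 : ℤ))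
      (powers_le_nonZeroDivisors_of_noZeroDivisors two_ne_zero)
    intro a b h
    exact this (by simpa using h)
  have hzero : ∀ z : Localization.Away (2 : ℤ),
      (Submodule.Quotient.mk z : ZHalfModZ) = 0 ↔ ∃ m : ℤ, (m : Localization.Away (2 : ℤ)) = z := by
    intro z
    rw [Submodule.Quotient.mk_eq_zero]
    rfl
  let g : ℤ →ₗ[ℤ] ZHalfModZ := LinearMap.toSpanSingleton ℤ _ (Submodule.Quotient.mk u)
  have hg : ∀ m : ℤ, g m = Submodule.Quotient.mk ((m : Localization.Away (2 : ℤ)) * u) := by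
    intro m
    rw [← zsmul_eq_mul]
    rfl
  have hker : ∀ m : ℤ, g m = 0 ↔ ((2 ^ k : ℕ) : ℤ) ∣ m := by
    intro m
    rw [hg, hzero]
    constructor
    · rintro ⟨a, ha⟩
      refine ⟨a, hcast ?_⟩
      push_cast
      rw [ha]
      linear_combination (-(m : Localization.Away (2 : ℤ))) * hu
    · rintro ⟨a, rfl⟩
      refine ⟨a, ?_⟩
      rw [Int.cast_mul]
      push_cast
      linear_combination (-(a : Localization.Away (2 : ℤ))) * hu
  let f : ZMod (2 ^ k) →+ ZHalfModZ :=
    ZMod.lift (2 ^ k) ⟨g.toAddMonoidHom, (hker _).2 dvd_rfl⟩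
  have hf : ∀ m : ℤ, f (m : ZMod (2 ^ k)) = g m := fun m => ZMod.lift_coe _ _ m
  refine ⟨f.toIntLinearMap, ?_, fun x => ⟨?_, fun hx => ?_⟩⟩
  · refine (injective_iff_map_eq_zero f).2 fun y hy => ?_
    obtain ⟨m, rfl⟩ := ZMod.intCast_surjective y
    rw [hf, hker] at hy
    exact (ZMod.intCast_zmod_eq_zero_iff_dvd _ _).2 hy
  · rintro ⟨y, rfl⟩
    obtain ⟨m, rfl⟩ := ZMod.intCast_surjective y
    change (2 ^ k : ℤ) • f _ = 0
    rw [hf, ← map_smul, hker]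
    exact ⟨m, by simp⟩
  · obtain ⟨z, rfl⟩ := Submodule.Quotient.mk_surjective _ x
    rw [← Submodule.Quotient.mk_smul, hzero] at hx
    obtain ⟨m, hm⟩ := hx
    refine ⟨m, ?_⟩
    change f _ = _
    rw [hf, hg, hm, zsmul_eq_mul]
    congr 1
    push_cast
    linear_combination z * hu

/-- for `s ≥ 2`, `T^{2^s} ≡ I + 2^{s+1}·[[0, E⁻¹],[-E⁻¹, 0]] (mod 2^{s+2})`,
and consequently for odd `r` the kernel of `T^{r·2^s} - I` acting on `(ℤ[1/2]/ℤ)^{2n}`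
is isomorphic to `(ℤ/2^{s+1})^{2n}`. -/
theorem propT_pow_two_pow_congruence (n : ℕ) (hn : 0 < n) (s : ℕ) (hs : 2 ≤ s) :
    (∀ i j, (propT n ^ 2 ^ s) i j ≡
        ((1 : Matrix (Fin n ⊕ Fin n) (Fin n ⊕ Fin n) ℤ) +
          (2 ^ (s + 1) : ℤ) • Matrix.fromBlocks 0 (skewE n)⁻¹ (-(skewE n)⁻¹) 0) i j
        [ZMOD (2 ^ (s + 2) : ℤ)]) ∧
      ∀ r : ℕ, Odd r →
        Nonempty (↥(LinearMap.ker (matAct (propT n ^ (r * 2 ^ s) - 1) ZHalfModZ)) ≃ₗ[ℤ]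
          ((Fin n ⊕ Fin n) → ZMod (2 ^ (s + 1)))) := by
  obtain ⟨s, rfl⟩ := Nat.exists_eq_add_of_le' hs
  obtain ⟨A, hA⟩ := exists_propT_pow_two_pow_eq n s
  obtain ⟨N, hN⟩ := exists_mul_leadingBlock_eq_one n
  refine ⟨fun i j => ?_, fun r hr => ?_⟩
  · rw [hA]
    refine Int.ModEq.symm (Int.modEq_iff_dvd.2 ⟨A i j, ?_⟩)
    change _ - ((1 : Matrix (Fin n ⊕ Fin n) (Fin n ⊕ Fin n) ℤ) +
      (2 ^ (s + 2 + 1) : ℤ) • leadingBlock n) i j = _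
    simp only [Matrix.add_apply, Matrix.smul_apply, smul_eq_mul]
    ring
  · obtain ⟨t, rfl⟩ := hr
    obtain ⟨B, hB⟩ := exists_pow_eq_one_add_smul (leadingBlock n) A (2 ^ (s + 2)) (2 * t + 1)
    have hpow : propT n ^ ((2 * t + 1) * 2 ^ (s + 2)) - 1
        = (2 ^ (s + 2 + 1) : ℤ) • (leadingBlock n + (2 : ℤ) • ((t : ℤ) • leadingBlock n + B)) := by
      rw [mul_comm, pow_mul, hA, show s + 3 = s + 2 + 1 from rfl, pow_succ' _ (s + 2), hB]
      push_cast
      module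
    rw [hpow]
    obtain ⟨f, hf, hrange⟩ := exists_zmod_linearMap_zHalfModZ (s + 2 + 1)
    have hinj : Function.Injective (f.compLeft (Fin n ⊕ Fin n)) := hf.comp_left
    refine ⟨((LinearEquiv.ofInjective _ hinj).trans (LinearEquiv.ofEq _ _ ?_)).symm⟩
    ext x
    rw [mem_ker_matAct_smul _ hN _ exists_two_pow_smul_zHalfModZ_eq_zero]
    constructor
    · rintro ⟨y, rfl⟩
      funext i
      exact (hrange _).1 ⟨y i, rfl⟩
    · intro hx
      choose y hy using fun i => (hrange (x i)).2 (congrFun hx i)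
      exact ⟨y, funext hy⟩
end

section
/- Let G be a connected graph without boundary with standard Laplacian over ℤ, and let f : G₁ → G₂ be a surjective harmonic morphism of finite connected graphs (surjective on vertices and edges). Then the induced map Crit(G₁) → Crit(G₂) on critical groups is surjective, and consequently the number of spanning trees of G₂ divides the number of spanning trees of G₁. -/
open Finsupp

/-- The augmentation map `ε : ℤV → ℤ` summing coordinates. -/
noncomputable def epsMap (N : DNetwork ℤ) : (N.V →₀ ℤ) →ₗ[ℤ] ℤ :=
  Finsupp.lsum ℤ fun _ => LinearMap.id

/-- A harmonic morphism between graphs (without boundary): vertices map to vertices, each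
oriented edge either maps to an oriented edge (compatibly with endpoints and reversal) or
collapses to a vertex, and over each vertex the non-collapsed edge fibers have constant size
`deg x`. -/
structure HMorphism {R : Type} [CommRing R] (N₁ N₂ : DNetwork R) where
  fV : N₁.V → N₂.V
  fE : N₁.E → Option N₂.E
  rev_none : ∀ e, fE e = none → fE (N₁.rev e) = none
  collapse_ok : ∀ e, fE e = none → fV (N₁.src e) = fV (N₁.tgt e)
  rev_some : ∀ e e', fE e = some e' → fE (N₁.rev e) = some (N₂.rev e')
  src_map : ∀ e e', fE e = some e' → N₂.src e' = fV (N₁.src e)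
  deg : N₁.V → ℕ
  fiber : ∀ (x : N₁.V) (e' : N₂.E), N₂.src e' = fV x →
    Nat.card {e : N₁.E // N₁.src e = x ∧ fE e = some e'} = deg x

/-- A spanning tree of a finite connected multigraph, encoded as a set of oriented edges
closed under reversal which connects all the vertices and has (unoriented) cardinality
`|V| - 1`. -/
def IsSpanningTree (N : DNetwork ℤ) (s : Set N.E) : Prop :=
  (∀ e ∈ s, N.rev e ∈ s) ∧
    (∀ x y : N.V,
      Relation.ReflTransGen (fun a b => ∃ e ∈ s, N.src e = a ∧ N.tgt e = b) x y) ∧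
    Nat.card s = 2 * (Nat.card N.V - 1)

theorem exists_rank_of_reflTransGen {α : Type*} (R : α → α → Prop) (q : α)
    (h : ∀ x, Relation.ReflTransGen R x q) :
    ∃ ρ : α → ℕ, ∀ x ≠ q, ∃ y, R x y ∧ ρ y < ρ x := by
  classical
  obtain ⟨P, hP₀, hPs⟩ : ∃ P : ℕ → α → Prop,
      (∀ x, P 0 x ↔ x = q) ∧ ∀ n x, P (n + 1) x ↔ ∃ y, R x y ∧ P n y :=
    ⟨fun n => Nat.rec (motive := fun _ => α → Prop) (· = q) (fun _ Q x => ∃ y, R x y ∧ Q y) n,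
      fun _ => Iff.rfl, fun _ _ => Iff.rfl⟩
  have hP : ∀ x, ∃ n, P n x := by
    intro x
    induction h x using Relation.ReflTransGen.head_induction_on with
    | refl => exact ⟨0, (hP₀ q).2 rfl⟩
    | head hxy _ ih =>
      obtain ⟨n, hn⟩ := ih
      exact ⟨n + 1, (hPs n _).2 ⟨_, hxy, hn⟩⟩
  refine ⟨fun x => Nat.find (hP x), fun x hx => ?_⟩
  have hs := Nat.find_spec (hP x)
  rcases hk : Nat.find (hP x) with _ | n
  · rw [hk, hP₀] at hs
    exact absurd hs hx
  · rw [hk, hPs] at hs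
    obtain ⟨y, hxy, hy⟩ := hs
    exact ⟨y, hxy, (Nat.lt_succ_of_le (Nat.find_min' (hP y) hy)).trans_eq hk.symm⟩

theorem reflTransGen_of_rank {α : Type*} (R : α → α → Prop) (q : α) (ρ : α → ℕ)
    (h : ∀ x ≠ q, ∃ y, R x y ∧ ρ y < ρ x) (x : α) : Relation.ReflTransGen R x q := by
  induction hn : ρ x using Nat.strong_induction_on generalizing x with
  | _ n ih =>
    by_cases hx : x = q
    · rw [hx]
    · obtain ⟨y, hxy, hy⟩ := h x hx
      exact (ih _ (hn ▸ hy) y rfl).head hxy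

namespace DNetwork

/-- A spanning tree with all edges oriented towards the root `q`, encoded by the function
sending each vertex other than `q` to its first edge on the way to `q`. -/
structure IsArborescence (N : DNetwork ℤ) (q : N.V) (r : N.V → Option N.E) : Prop where
  root : r q = none
  exists_edge : ∀ x ≠ q, ∃ e, r x = some e ∧ N.src e = x
  exists_rank : ∃ ρ : N.V → ℕ, ∀ x e, r x = some e → ρ (N.tgt e) < ρ x

/-- The set of oriented edges that, up to reversal, are chosen by `r`. -/
def edgesOf (N : DNetwork ℤ) (r : N.V → Option N.E) : Set N.E :=
  {e | r (N.src e) = some e ∨ r (N.tgt e) = some (N.rev e)}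

variable (N : DNetwork ℤ)

@[simp]
theorem tgt_rev (e : N.E) : N.tgt (N.rev e) = N.src e := by
  simp [tgt, N.rev_rev]

@[simp]
theorem src_rev (e : N.E) : N.src (N.rev e) = N.tgt e := rfl

variable {N}

namespace IsArborescence

variable {q : N.V} {r r' : N.V → Option N.E}

theorem src_eq (h : N.IsArborescence q r) {x : N.V} {e : N.E} (he : r x = some e) :
    N.src e = x := by
  have hx : x ≠ q := by
    rintro rfl
    simp [h.root] at he
  obtain ⟨e', he', hs⟩ := h.exists_edge x hx
  rw [he] at he'
  cases he'
  exact hs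

theorem rev_mem_edgesOf {e : N.E} (he : e ∈ N.edgesOf r) : N.rev e ∈ N.edgesOf r := by
  rcases he with he | he
  · exact Or.inr (by simpa [N.rev_rev] using he)
  · exact Or.inl he

theorem not_both (h : N.IsArborescence q r) {e : N.E} (h₁ : r (N.src e) = some e)
    (h₂ : r (N.tgt e) = some (N.rev e)) : False := by
  obtain ⟨ρ, hρ⟩ := h.exists_rank
  have := hρ _ _ h₁
  have := hρ _ _ h₂
  rw [tgt_rev] at this
  omega

theorem card_edgesOf [Finite N.V] [Finite N.E] (h : N.IsArborescence q r) :
    Nat.card (N.edgesOf r) = 2 * (Nat.card N.V - 1) := by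
  classical
  let A : Set N.E := {e | r (N.src e) = some e}
  have hA : A.ncard = Nat.card N.V - 1 := by
    have himg : N.src '' A = {q}ᶜ := by
      ext x
      constructor
      · rintro ⟨e, he, rfl⟩ hq
        rw [Set.mem_singleton_iff] at hq
        have : r (N.src e) = some e := he
        simp [hq, h.root] at this
      · intro hx
        obtain ⟨e, he, hs⟩ := h.exists_edge x hx
        exact ⟨e, by simpa [A, hs] using he, hs⟩
    have hinj : Set.InjOn N.src A := by
      intro e he e' he' hee
      have h₁ : r (N.src e) = some e := he
      have h₂ : r (N.src e') = some e' := he'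
      rw [hee, h₂] at h₁
      exact (Option.some.inj h₁).symm
    rw [← hinj.ncard_image, himg, Set.ncard_compl, Set.ncard_singleton]
  have hrev : Function.Injective N.rev := fun a b hab => by
    rw [← N.rev_rev a, hab, N.rev_rev]
  have hU : N.edgesOf r = A ∪ N.rev '' A := by
    ext e
    constructor
    · rintro (he | he)
      · exact Or.inl he
      · exact Or.inr ⟨N.rev e, he, N.rev_rev e⟩
    · rintro (he | ⟨e, he, rfl⟩)
      · exact Or.inl he
      · exact rev_mem_edgesOf (Or.inl he)
  have hd : Disjoint A (N.rev '' A) := by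
    rw [Set.disjoint_left]
    rintro _ he ⟨e, he', rfl⟩
    exact h.not_both he' he
  rw [Nat.card_coe_set_eq, hU, Set.ncard_union_eq hd, Set.ncard_image_of_injective _ hrev, hA]
  omega

theorem isSpanningTree_edgesOf [Finite N.V] [Finite N.E] (h : N.IsArborescence q r) :
    IsSpanningTree N (N.edgesOf r) := by
  refine ⟨fun e he => rev_mem_edgesOf he, fun x y => ?_, h.card_edgesOf⟩
  set R : N.V → N.V → Prop := fun a b => ∃ e ∈ N.edgesOf r, N.src e = a ∧ N.tgt e = b
  have hsymm : Std.Symm R := ⟨fun a b ⟨e, he, ha, hb⟩ =>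
    ⟨N.rev e, rev_mem_edgesOf he, hb, by rw [tgt_rev, ha]⟩⟩
  obtain ⟨ρ, hρ⟩ := h.exists_rank
  have hq : ∀ x, Relation.ReflTransGen R x q := by
    refine reflTransGen_of_rank R q ρ fun x hx => ?_
    obtain ⟨e, he, rfl⟩ := h.exists_edge x hx
    exact ⟨N.tgt e, ⟨e, Or.inl he, rfl, rfl⟩, hρ _ _ he⟩
  exact (hq x).trans (Relation.ReflTransGen.stdSymm.symm _ _ (hq y))

theorem eq_of_edgesOf_eq (h : N.IsArborescence q r) (h' : N.IsArborescence q r')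
    (heq : N.edgesOf r = N.edgesOf r') : r = r' := by
  obtain ⟨ρ, hρ⟩ := h'.exists_rank
  funext x
  induction hn : ρ x using Nat.strong_induction_on generalizing x with
  | _ n ih =>
    by_cases hx : x = q
    · rw [hx, h.root, h'.root]
    · obtain ⟨e, he, rfl⟩ := h'.exists_edge x hx
      have hmem : e ∈ N.edgesOf r := heq ▸ Or.inl he
      rcases hmem with hmem | hmem
      · rw [hmem, he]
      · rw [ih _ (hn ▸ hρ _ _ he) _ rfl] at hmem
        exact (h'.not_both he hmem).elim

end IsArborescence

theorem exists_isArborescence_of_reflTransGen (q : N.V) (s : Set N.E)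
    (h : ∀ x, Relation.ReflTransGen (fun a b => ∃ e ∈ s, N.src e = a ∧ N.tgt e = b) x q) :
    ∃ r, N.IsArborescence q r ∧ ∀ x e, r x = some e → e ∈ s := by
  classical
  obtain ⟨ρ, hρ⟩ := exists_rank_of_reflTransGen _ q h
  have hρ' : ∀ x, x ≠ q → ∃ e ∈ s, N.src e = x ∧ ρ (N.tgt e) < ρ x := by
    intro x hx
    obtain ⟨_, ⟨e, he, hs, rfl⟩, hlt⟩ := hρ x hx
    exact ⟨e, he, hs, hlt⟩
  choose p hps hpx hpρ using hρ'
  have hr : ∀ x e, (if hx : x = q then none else some (p x hx)) = some e →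
      ∃ hx : x ≠ q, p x hx = e := by
    intro x e he
    split_ifs at he with hx
    exact ⟨hx, Option.some.inj he⟩
  refine ⟨fun x => if hx : x = q then none else some (p x hx),
    ⟨by simp, fun x hx => ⟨p x hx, by simp [hx], hpx x hx⟩, ρ, fun x e he => ?_⟩,
    fun x e he => ?_⟩
  · obtain ⟨hx, rfl⟩ := hr x e he
    exact hpρ x hx
  · obtain ⟨hx, rfl⟩ := hr x e he
    exact hps x hx

theorem card_spanningTree_eq_card_arborescence [Finite N.V] [Finite N.E] (q : N.V) :
    Nat.card {s : Set N.E // IsSpanningTree N s} = Nat.card {r // N.IsArborescence q r} := by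
  symm
  refine Nat.card_congr (Equiv.ofBijective
    (fun r => ⟨N.edgesOf r.1, r.2.isSpanningTree_edgesOf⟩) ⟨fun r r' h => ?_, fun s => ?_⟩)
  · exact Subtype.ext (r.2.eq_of_edgesOf_eq r'.2 (congrArg Subtype.val h))
  · obtain ⟨s, hrev, hconn, hcard⟩ := s
    obtain ⟨r, hr, hrs⟩ := exists_isArborescence_of_reflTransGen q s fun x => hconn x q
    refine ⟨⟨r, hr⟩, Subtype.ext (Set.eq_of_subset_of_ncard_le ?_ ?_)⟩
    · rintro e (he | he)
      · exact hrs _ _ he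
      · rw [← N.rev_rev e]
        exact hrev _ (hrs _ _ he)
    · rw [← Nat.card_coe_set_eq, ← Nat.card_coe_set_eq, hcard, hr.card_edgesOf]

theorem exists_isArborescence (h : N.Connected) (q : N.V) : ∃ r, N.IsArborescence q r := by
  obtain ⟨r, hr, -⟩ := exists_isArborescence_of_reflTransGen q Set.univ fun x => by
    simp only [Set.mem_univ, true_and]
    exact h x q
  exact ⟨r, hr⟩

/-- The row `x - tgt o` of the matrix of a partial choice of edges; there is no second term if no
edge is chosen. -/
noncomputable def choiceRow (N : DNetwork ℤ) (x : N.V) (o : Option N.E) : N.V →₀ ℤ :=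
  single x 1 - o.elim 0 fun e => single (N.tgt e) 1

open Classical in
/-- The Laplacian with the row of the root `q` replaced by the basis vector of `q`. -/
noncomputable def rootedLap (N : DNetwork ℤ) (q x : N.V) : N.V →₀ ℤ :=
  if x = q then single q 1 else N.lapSingle x

theorem lapSingle_eq_sum [Fintype N.E] [DecidableEq N.V] (hw : ∀ e, N.w e = 1)
    (hd : ∀ x, N.d x = 0) (x : N.V) :
    N.lapSingle x = ∑ e with N.src e = x, (single x 1 - single (N.tgt e) (1 : ℤ)) := by
  let := N.finE x
  rw [lapSingle, hd, zero_smul, zero_add]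
  simp only [hw, one_smul]
  rw [Finset.sum_subtype (Finset.univ.filter fun e => N.src e = x) (p := fun e => N.src e = x)
    (by simp) (fun e => single x 1 - single (N.tgt e) (1 : ℤ))]

theorem sum_lapSingle [Fintype N.V] [Fintype N.E] (hw : ∀ e, N.w e = 1) (hd : ∀ x, N.d x = 0) :
    ∑ x, N.lapSingle x = 0 := by
  classical
  have h : ∑ x, N.lapSingle x = ∑ e, (single (N.src e) 1 - single (N.tgt e) (1 : ℤ)) := by
    rw [← Finset.sum_fiberwise _ N.src]
    refine Finset.sum_congr rfl fun x _ => ?_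
    rw [lapSingle_eq_sum hw hd]
    refine Finset.sum_congr rfl fun e he => ?_
    rw [(Finset.mem_filter.1 he).2]
  rw [h, Finset.sum_sub_distrib, sub_eq_zero]
  exact Fintype.sum_equiv ⟨N.rev, N.rev, N.rev_rev, N.rev_rev⟩ _ _ fun e => by simp

theorem IsArborescence.det_choiceRow [Fintype N.V] [DecidableEq N.V] {q : N.V}
    {r : N.V → Option N.E} (h : N.IsArborescence q r) :
    (Finsupp.basisSingleOne (R := ℤ)).det (fun x => N.choiceRow x (r x)) = 1 := by
  obtain ⟨ρ, hρ⟩ := h.exists_rank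
  rw [Module.Basis.det_apply]
  have hentry : ∀ i j, ρ j ≤ ρ i → (Finsupp.basisSingleOne (R := ℤ)).toMatrix
      (fun x => N.choiceRow x (r x)) i j = (1 : Matrix N.V N.V ℤ) i j := by
    intro i j hij
    have h0 : ((r j).elim 0 fun e => single (N.tgt e) (1 : ℤ)) i = 0 := by
      rcases hrj : r j with _ | e
      · simp
      · have := hρ _ _ hrj
        have hne : N.tgt e ≠ i := by
          rintro rfl
          omega
        simp [hne]
    simp [Module.Basis.toMatrix_apply, choiceRow, h0, Matrix.one_apply, Finsupp.single_apply,
      eq_comm]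
  have htri : ((Finsupp.basisSingleOne (R := ℤ)).toMatrix
      (fun x => N.choiceRow x (r x))).BlockTriangular ρ := fun i j hij => by
    rw [hentry i j hij.le, Matrix.one_apply_ne (by rintro rfl; omega)]
  rw [htri.det]
  refine Finset.prod_eq_one fun k _ => ?_
  rw [← Matrix.det_one (n := {a // ρ a = k})]
  congr 1
  ext i j
  rw [Matrix.toSquareBlock_def, Matrix.of_apply, hentry _ _ (by rw [i.2, j.2])]
  simp [Matrix.one_apply, Subtype.ext_iff]

theorem det_choiceRow_eq_zero [Fintype N.V] [DecidableEq N.V] {q : N.V}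
    {r : N.V → Option N.E} (hq : r q = none) (hr : ∀ x ≠ q, ∃ e, r x = some e ∧ N.src e = x)
    (h : ¬ N.IsArborescence q r) :
    (Finsupp.basisSingleOne (R := ℤ)).det (fun x => N.choiceRow x (r x)) = 0 := by
  classical
  let R : N.V → N.V → Prop := fun a b => ∃ e, r a = some e ∧ N.tgt e = b
  have hreach : ∃ x, ¬ Relation.ReflTransGen R x q := by
    by_contra! hall
    obtain ⟨ρ, hρ⟩ := exists_rank_of_reflTransGen R q hall
    refine h ⟨hq, hr, ρ, fun x e he => ?_⟩
    have hx : x ≠ q := by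
      rintro rfl
      simp [hq] at he
    obtain ⟨y, ⟨e', he', rfl⟩, hlt⟩ := hρ x hx
    rw [he] at he'
    cases he'
    exact hlt
  obtain ⟨x₀, hx₀⟩ := hreach
  rw [Module.Basis.det_apply, ← Matrix.exists_vecMul_eq_zero_iff]
  let v : N.V → ℤ := fun x => if Relation.ReflTransGen R x q then 0 else 1
  refine ⟨v, fun hv => ?_, ?_⟩
  · have := congrFun hv x₀
    simp [v, hx₀] at this
  · ext j
    have hj : v j = (r j).elim 0 fun e => v (N.tgt e) := by
      by_cases hjq : j = q
      · subst hjq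
        simp [hq, v, Relation.ReflTransGen.refl]
      · obtain ⟨e, he, -⟩ := hr j hjq
        have hiff : Relation.ReflTransGen R j q ↔ Relation.ReflTransGen R (N.tgt e) q := by
          constructor
          · intro hjr
            rcases hjr.cases_head with hjr | ⟨c, ⟨e', he', rfl⟩, hc⟩
            · exact absurd hjr hjq
            · rw [he] at he'
              cases he'
              exact hc
          · exact fun ht => ht.head ⟨e, he, rfl⟩
        simp [he, v, hiff]
    rcases hrj : r j with _ | e <;> rw [hrj] at hj <;>
      simp [Matrix.vecMul, dotProduct, Module.Basis.toMatrix_apply, choiceRow, hrj,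
        Finsupp.single_apply, mul_sub, Finset.sum_sub_distrib] at hj ⊢ <;> simp [hj]

theorem det_rootedLap [Fintype N.V] [DecidableEq N.V] [Fintype N.E] (hw : ∀ e, N.w e = 1)
    (hd : ∀ x, N.d x = 0) (q : N.V) :
    (Finsupp.basisSingleOne (R := ℤ)).det (N.rootedLap q) =
      Nat.card {r // N.IsArborescence q r} := by
  classical
  let A : N.V → Finset (Option N.E) := fun x =>
    if x = q then {none} else (Finset.univ.filter fun e => N.src e = x).map .some
  have hA : N.rootedLap q = fun x => ∑ o ∈ A x, N.choiceRow x o := by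
    funext x
    by_cases hx : x = q
    · simp [rootedLap, A, hx, choiceRow]
    · simp [rootedLap, A, hx, choiceRow, lapSingle_eq_sum hw hd]
  have hmem : ∀ r : N.V → Option N.E, r ∈ Fintype.piFinset A ↔
      r q = none ∧ ∀ x ≠ q, ∃ e, r x = some e ∧ N.src e = x := by
    intro r
    rw [Fintype.mem_piFinset]
    constructor
    · refine fun h => ⟨by simpa [A] using h q, fun x hx => ?_⟩
      obtain ⟨e, hs, he⟩ := by simpa [A, hx] using h x
      exact ⟨e, he.symm, hs⟩
    · rintro ⟨hq, hr⟩ x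
      by_cases hx : x = q
      · simp [A, hx, hq]
      · obtain ⟨e, he, hs⟩ := hr x hx
        simp [A, hx, he, hs]
  have hterm : ∀ r ∈ Fintype.piFinset A,
      (Finsupp.basisSingleOne (R := ℤ)).det (fun x => N.choiceRow x (r x)) =
        if N.IsArborescence q r then 1 else 0 := by
    intro r hr
    rw [hmem] at hr
    split_ifs with h
    · exact h.det_choiceRow
    · exact det_choiceRow_eq_zero hr.1 hr.2 h
  rw [hA, ← AlternatingMap.coe_multilinearMap, MultilinearMap.map_sum_finset]
  simp only [AlternatingMap.coe_multilinearMap]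
  rw [Finset.sum_congr rfl hterm, Finset.sum_boole, Nat.card_eq_fintype_card,
    Fintype.card_subtype]
  congr 2
  ext r
  simp only [Finset.mem_filter, Finset.mem_univ, true_and, and_iff_right_iff_imp]
  exact fun h => (hmem r).2 ⟨h.root, h.exists_edge⟩

theorem _root_.Module.Basis.card_quotient_span_range {ι M : Type*} [Fintype ι] [DecidableEq ι]
    [AddCommGroup M] (b : Module.Basis ι ℤ M) (v : ι → M) (h : b.det v ≠ 0) :
    Nat.card (M ⧸ Submodule.span ℤ (Set.range v)) = (b.det v).natAbs := by
  have : Module.Free ℤ M := .of_basis b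
  have : Module.Finite ℤ M := .of_basis b
  have hli : LinearIndependent ℤ v := by
    by_contra hv
    exact h (b.det.map_linearDependent v hv)
  rw [← Submodule.natAbs_det_basis_change b _ (Module.Basis.span hli)]
  congr 2
  funext i
  simp [Module.Basis.span_apply]

/-- A form of the matrix-tree theorem: the cokernel of the reduced Laplacian has as many elements
as the graph has spanning trees. -/
theorem card_quotient_rootedLap [Fintype N.V] [Fintype N.E] (hconn : N.Connected)
    (hw : ∀ e, N.w e = 1) (hd : ∀ x, N.d x = 0) (q : N.V) :
    Nat.card ((N.V →₀ ℤ) ⧸ Submodule.span ℤ (Set.range (N.rootedLap q))) =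
      Nat.card {s : Set N.E // IsSpanningTree N s} := by
  classical
  have hdet := det_rootedLap hw hd q
  obtain ⟨r, hr⟩ := exists_isArborescence hconn q
  have : Nonempty {r // N.IsArborescence q r} := ⟨⟨r, hr⟩⟩
  rw [Module.Basis.card_quotient_span_range Finsupp.basisSingleOne _
    (by rw [hdet]; exact_mod_cast Nat.card_pos.ne'), hdet, Int.natAbs_natCast,
    card_spanningTree_eq_card_arborescence q]

theorem lapSingle_mem_span_rootedLap [Fintype N.V] [Fintype N.E] (hw : ∀ e, N.w e = 1)
    (hd : ∀ x, N.d x = 0) (q x : N.V) :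
    N.lapSingle x ∈ Submodule.span ℤ (Set.range (N.rootedLap q)) := by
  classical
  have hne : ∀ y ≠ q, N.lapSingle y ∈ Submodule.span ℤ (Set.range (N.rootedLap q)) :=
    fun y hy => Submodule.subset_span ⟨y, by simp [rootedLap, hy]⟩
  by_cases hx : x = q
  · have hsum := sum_lapSingle hw hd
    rw [← Finset.add_sum_erase _ _ (Finset.mem_univ x), add_eq_zero_iff_eq_neg] at hsum
    rw [hsum]
    exact neg_mem (sum_mem fun y hy => hne y (hx ▸ Finset.ne_of_mem_erase hy))
  · exact hne x hx

theorem lapImage_eq_span (hb : N.boundary = ∅) :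
    N.lapImage = Submodule.span ℤ (Set.range N.lapSingle) := by
  have hint : N.interior = Set.univ := by simp [interior, hb]
  have hlap : N.chainLap = Finsupp.linearCombination ℤ N.lapSingle := by
    ext
    simp [chainLap]
  rw [lapImage, hint, Finsupp.supported_univ, Submodule.map_top, hlap,
    Finsupp.range_linearCombination]

end DNetwork

namespace HMorphism

variable {N₁ N₂ : DNetwork ℤ}

theorem mapDomain_lapSingle [Fintype N₁.E] [Fintype N₂.E]
    (hw₁ : ∀ e, N₁.w e = 1) (hd₁ : ∀ x, N₁.d x = 0)
    (hw₂ : ∀ e, N₂.w e = 1) (hd₂ : ∀ x, N₂.d x = 0) (f : HMorphism N₁ N₂) (x : N₁.V) :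
    Finsupp.mapDomain f.fV (N₁.lapSingle x) = (f.deg x : ℤ) • N₂.lapSingle (f.fV x) := by
  classical
  rw [DNetwork.lapSingle_eq_sum hw₁ hd₁, DNetwork.lapSingle_eq_sum hw₂ hd₂,
    Finsupp.mapDomain_finsetSum, Finset.smul_sum]
  let g : Option N₂.E → N₂.V →₀ ℤ := fun o =>
    o.elim 0 fun e' => single (f.fV x) 1 - single (N₂.tgt e') 1
  have hg : ∀ e ∈ Finset.univ.filter fun e => N₁.src e = x,
      Finsupp.mapDomain f.fV (single x 1 - single (N₁.tgt e) (1 : ℤ)) = g (f.fE e) := by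
    intro e he
    obtain rfl := (Finset.mem_filter.1 he).2
    rw [Finsupp.mapDomain_sub, Finsupp.mapDomain_single, Finsupp.mapDomain_single]
    rcases hfe : f.fE e with _ | e'
    · simp [g, f.collapse_ok e hfe]
    · have : N₂.tgt e' = f.fV (N₁.tgt e) := f.src_map _ _ (f.rev_some _ _ hfe)
      simp [g, this]
  rw [Finset.sum_congr rfl hg, ← Finset.sum_fiberwise _ f.fE, Fintype.sum_option]
  rw [Finset.sum_eq_zero (s := Finset.filter (fun e => f.fE e = none) _)
    (fun e he => by simp [g, (Finset.mem_filter.1 he).2]), zero_add, Finset.sum_filter]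
  refine Finset.sum_congr rfl fun e' _ => ?_
  split_ifs with hs
  · rw [Finset.sum_congr rfl fun e he => by rw [(Finset.mem_filter.1 he).2], Finset.sum_const,
      ← f.fiber x e' hs, Finset.filter_filter, Nat.card_eq_fintype_card, Fintype.card_subtype,
      natCast_zsmul]
    rfl
  · refine Finset.sum_eq_zero fun e he => (hs ?_).elim
    simp only [Finset.mem_filter, Finset.mem_univ, true_and] at he
    rw [f.src_map _ _ he.2, he.1]

end HMorphism

theorem epsMap_mapDomain {N₁ N₂ : DNetwork ℤ} (g : N₁.V → N₂.V) (u : N₁.V →₀ ℤ) :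
    epsMap N₂ (Finsupp.mapDomain g u) = epsMap N₁ u := by
  simp only [epsMap, Finsupp.lsum_apply, LinearMap.id_coe]
  exact Finsupp.sum_mapDomain_index (by simp) (by simp)

/-- a surjective harmonic morphism of finite connected graphs (without
boundary, standard Laplacian) induces a surjection of critical groups, and consequently the
number of spanning trees of `G₂` divides the number of spanning trees of `G₁`. -/
theorem crit_surjective_and_spanningTree_count_dvd
    (N₁ N₂ : DNetwork ℤ) [Fintype N₁.V] [Fintype N₂.V] [Fintype N₁.E] [Fintype N₂.E]
    (hb₁ : N₁.boundary = ∅) (hb₂ : N₂.boundary = ∅)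
    (hconn₁ : N₁.Connected) (hconn₂ : N₂.Connected)
    (hw₁ : ∀ e, N₁.w e = 1) (hd₁ : ∀ x, N₁.d x = 0)
    (hw₂ : ∀ e, N₂.w e = 1) (hd₂ : ∀ x, N₂.d x = 0)
    (f : HMorphism N₁ N₂)
    (hsurjV : Function.Surjective f.fV)
    (hsurjE : ∀ e' : N₂.E, ∃ e : N₁.E, f.fE e = some e') :
    (∃ φ : N₁.Upsilon →ₗ[ℤ] N₂.Upsilon,
      (∀ v : N₁.V,
        φ (N₁.lapImage.mkQ (Finsupp.single v 1)) =
          N₂.lapImage.mkQ (Finsupp.single (f.fV v) 1)) ∧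
      Submodule.map φ (Submodule.map N₁.lapImage.mkQ (LinearMap.ker (epsMap N₁))) =
        Submodule.map N₂.lapImage.mkQ (LinearMap.ker (epsMap N₂))) ∧
    Nat.card {s : Set N₂.E // IsSpanningTree N₂ s} ∣
      Nat.card {s : Set N₁.E // IsSpanningTree N₁ s} := by
  have hlap := f.mapDomain_lapSingle hw₁ hd₁ hw₂ hd₂
  let F : (N₁.V →₀ ℤ) →ₗ[ℤ] (N₂.V →₀ ℤ) := Finsupp.lmapDomain ℤ ℤ f.fV
  have hF : Function.Surjective F := Finsupp.mapDomain_surjective hsurjV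
  refine ⟨⟨Submodule.mapQ _ _ F ?_, fun v => ?_, ?_⟩, ?_⟩
  · rw [DNetwork.lapImage_eq_span hb₁, DNetwork.lapImage_eq_span hb₂, Submodule.span_le]
    rintro _ ⟨x, rfl⟩
    have : F (N₁.lapSingle x) = _ := hlap x
    rw [SetLike.mem_coe, Submodule.mem_comap, this]
    exact Submodule.smul_mem _ _ (Submodule.subset_span ⟨_, rfl⟩)
  · simp [F]
  · rw [← Submodule.map_comp, Submodule.mapQ_mkQ, Submodule.map_comp]
    congr 1
    ext u
    constructor
    · rintro ⟨v, hv, rfl⟩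
      exact (epsMap_mapDomain f.fV v).trans hv
    · intro hu
      obtain ⟨v, rfl⟩ := hF u
      exact ⟨v, (epsMap_mapDomain f.fV v).symm.trans hu, rfl⟩
  · rcases isEmpty_or_nonempty N₁.V with hV | ⟨⟨q⟩⟩
    · have : IsEmpty N₁.E := ⟨fun e => hV.elim (N₁.src e)⟩
      have : IsEmpty N₂.V := ⟨fun y => (hsurjV y).elim fun x _ => hV.elim x⟩
      have : IsEmpty N₂.E := ⟨fun e => isEmptyElim (N₂.src e)⟩
      have h₂ : Nat.card {s : Set N₂.E // IsSpanningTree N₂ s} = 1 := by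
        rw [Nat.card_eq_one_iff_unique]
        refine ⟨inferInstance, ⟨⟨∅, ?_⟩⟩⟩
        exact ⟨by simp, fun x => isEmptyElim x, by simp⟩
      rw [h₂]
      exact one_dvd _
    · rw [← DNetwork.card_quotient_rootedLap hconn₁ hw₁ hd₁ q,
        ← DNetwork.card_quotient_rootedLap hconn₂ hw₂ hd₂ (f.fV q)]
      have hle : Submodule.span ℤ (Set.range (N₁.rootedLap q)) ≤
          (Submodule.span ℤ (Set.range (N₂.rootedLap (f.fV q)))).comap F := by
        rw [Submodule.span_le]
        rintro _ ⟨x, rfl⟩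
        rw [SetLike.mem_coe, Submodule.mem_comap]
        by_cases hx : x = q
        · exact Submodule.subset_span ⟨f.fV q, by simp [DNetwork.rootedLap, hx, F]⟩
        · have : F (N₁.rootedLap q x) = (f.deg x : ℤ) • N₂.lapSingle (f.fV x) := by
            rw [DNetwork.rootedLap, if_neg hx]
            exact hlap x
          rw [this]
          exact Submodule.smul_mem _ _ (DNetwork.lapSingle_mem_span_rootedLap hw₂ hd₂ _ _)
      refine AddSubgroup.card_dvd_of_surjective (Submodule.mapQ _ _ F hle).toAddMonoidHom fun y => ?_
      obtain ⟨u, rfl⟩ := Submodule.mkQ_surjective _ y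
      obtain ⟨v, rfl⟩ := hF u
      exact ⟨Submodule.mkQ _ v, rfl⟩
end
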